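/- Let X be a nonempty finite poset in P^f_1. If for every x ∈ X the down-set ↓x = {y ∈ X : y ≤ x}, with the induced order, is a lattice, then the preordered class Un_1(X) of 1-unifiers for X admits a minimal complete set of cardinality 1 (type 1); otherwise Un_1(X) admits no minimal complete set (type 0). -/

import Mathlib

/-- The set of minimal elements of a poset `X` lying below `x`. -/
def minBelow (X : Type*) [PartialOrder X] (x : X) : Set X :=
  {m | m ≤ x ∧ ∀ z : X, z ≤ m → z = m}

/-- A p-morphism between posets: a monotone map commuting with `minBelow`. -/
def IsPMorphism {X Y : Type*} [PartialOrder X] [PartialOrder Y] (u : X → Y) : Prop :=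
  Monotone u ∧ ∀ x : X, u '' minBelow X x = minBelow Y (u x)

/-- Condition `(*)`. -/
def StarCond (X : Type*) [PartialOrder X] : Prop :=
  ∀ x y : X, ∃ z : X, IsLUB {x, y} z ∧ minBelow X z = minBelow X x ∪ minBelow X y

/-- Condition `(*_n)` for `n ≥ 1`. -/
def StarCondN (n : ℕ) (X : Type*) [PartialOrder X] : Prop :=
  ∀ x y : X, (minBelow X x ∪ minBelow X y).ncard ≤ n →
    ∃ z : X, IsLUB {x, y} z ∧ minBelow X z = minBelow X x ∪ minBelow X y

/-- Condition `(*_n)` with the convention that `(*_0)` means nonempty. -/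
def StarCondN' (n : ℕ) (X : Type*) [PartialOrder X] : Prop :=
  if n = 0 then Nonempty X else StarCondN n X

/-- The poset `X` belongs to the class `P^f_n`. -/
def InPfn (n : ℕ) (X : Type*) [PartialOrder X] : Prop :=
  ∀ x : X, (minBelow X x).ncard ≤ n

/-- `M` is a complete set for the preordered class `(S, le)`. -/
def IsCompleteSet {S : Type*} (le : S → S → Prop) (M : Set S) : Prop :=
  ∀ x : S, ∃ y ∈ M, le x y

/-- `M` is a minimal complete set for the preordered class `(S, le)`. -/
def IsMinimalCompleteSet {S : Type*} (le : S → S → Prop) (M : Set S) : Prop :=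
  IsCompleteSet le M ∧ ∀ x ∈ M, ∀ y ∈ M, le x y → x = y

/-- A connected subset of a poset. -/
def IsConnectedSub (X : Type*) [PartialOrder X] (Y : Set X) : Prop :=
  (∀ y ∈ Y, minBelow X y ⊆ Y) ∧
  ∀ x ∈ Y, ∀ y ∈ Y, ∃ z ∈ Y, x ≤ z ∧ y ≤ z ∧
    minBelow X z = minBelow X x ∪ minBelow X y

/-- An `n`-connected subset of a poset. -/
def IsNConnectedSub (n : ℕ) (X : Type*) [PartialOrder X] (Y : Set X) : Prop :=
  (∀ y ∈ Y, minBelow X y ⊆ Y) ∧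
  (∀ S : Set X, S ⊆ (⋃ y ∈ Y, minBelow X y) → S.Nonempty → S.ncard ≤ n →
    ∃ z ∈ Y, minBelow X z = S) ∧
  (∀ x ∈ Y, ∀ y ∈ Y, minBelow X x = minBelow X y → (minBelow X x).ncard < n →
    ∃ (r : ℕ) (c : ℕ → X), c 0 = x ∧ c r = y ∧ (∀ i ≤ r, c i ∈ Y) ∧
      (∀ i ≤ r, minBelow X (c i) = minBelow X x) ∧
      (∀ i < r, if Even i then c (i + 1) ≤ c i else c i ≤ c (i + 1)))

/-- The special product `X ⊙ Y`. -/
abbrev Odot (X Y : Type*) : Type _ :=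
  {p : WithBot X × WithBot Y // p ≠ (⊥, ⊥)}

/-- The subposet `(X)_n` of elements with at most `n` minimal elements below them. -/
abbrev SubPn (n : ℕ) (X : Type*) [PartialOrder X] : Type _ :=
  {x : X // (minBelow X x).ncard ≤ n}

/-- A unifier for a finite poset `X`: a p-morphism into `X` from a nonempty finite
poset satisfying `(*)`. -/
structure Unifier (X : Type) [PartialOrder X] [Finite X] : Type 1 where
  Y : Type
  [po : PartialOrder Y]
  [fin : Finite Y]
  ne : Nonempty Y
  star : StarCond Y
  u : Y → X
  hu : IsPMorphism u

attribute [instance] Unifier.po Unifier.fin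

/-- The "more general" preorder on unifiers: `v ≼ w`. -/
def UnifierLE {X : Type} [PartialOrder X] [Finite X] (v w : Unifier X) : Prop :=
  ∃ ψ : v.Y → w.Y, IsPMorphism ψ ∧ w.u ∘ ψ = v.u

/-- An `n`-unifier for a finite poset `X` in `P^f_n`. -/
structure UnifierN (n : ℕ) (X : Type) [PartialOrder X] [Finite X] : Type 1 where
  Y : Type
  [po : PartialOrder Y]
  [fin : Finite Y]
  ne : Nonempty Y
  mem : InPfn n Y
  star : StarCondN n Y
  u : Y → X
  hu : IsPMorphism u

attribute [instance] UnifierN.po UnifierN.fin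

/-- The "more general" preorder on `n`-unifiers: `v ≼ w`. -/
def UnifierNLE {n : ℕ} {X : Type} [PartialOrder X] [Finite X] (v w : UnifierN n X) : Prop :=
  ∃ ψ : v.Y → w.Y, IsPMorphism ψ ∧ w.u ∘ ψ = v.u

theorem Sum.isMin_inl_iff {α β : Type*} [Preorder α] [Preorder β] {a : α} :
    IsMin (Sum.inl a : α ⊕ β) ↔ IsMin a := by
  simp [IsMin]

theorem Sum.isMin_inr_iff {α β : Type*} [Preorder α] [Preorder β] {b : β} :
    IsMin (Sum.inr b : α ⊕ β) ↔ IsMin b := by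
  simp [IsMin]

section Basic

variable {P Q : Type} [PartialOrder P] [PartialOrder Q]

theorem mem_minBelow_iff {x m : P} : m ∈ minBelow P x ↔ m ≤ x ∧ IsMin m :=
  and_congr_right fun _ =>
    ⟨fun h z hz => (h z hz).ge, fun h _ hz => h.eq_of_le hz⟩

theorem exists_isMin_le [Finite P] (x : P) : ∃ m, m ≤ x ∧ IsMin m := by
  obtain ⟨m, hm, hmin⟩ := Set.finite_univ.exists_le_minimal (Set.mem_univ x)
  exact ⟨m, hm, fun z hz => hmin.2 (Set.mem_univ z) hz⟩

theorem inPfn_one_iff [Finite P] :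
    InPfn 1 P ↔ ∀ x m n : P, m ≤ x → n ≤ x → IsMin m → IsMin n → m = n := by
  refine forall_congr' fun x => ?_
  rw [Set.ncard_le_one_iff (Set.toFinite _)]
  simp only [mem_minBelow_iff]
  exact ⟨fun h m n hm hn hm' hn' => h ⟨hm, hm'⟩ ⟨hn, hn'⟩,
    fun h m n hm hn => h m n hm.1 hn.1 hm.2 hn.2⟩

theorem minBelow_subset_of_le {x y : P} (h : x ≤ y) : minBelow P x ⊆ minBelow P y :=
  fun _ hm => ⟨hm.1.trans h, hm.2⟩

theorem minBelow_nonempty [Finite P] (x : P) : (minBelow P x).Nonempty :=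
  (exists_isMin_le x).imp fun _ hm => mem_minBelow_iff.2 hm

/-- In `P^f_1`, a nonempty subset of `minBelow P x` is all of it. -/
theorem InPfn.eq_minBelow [Finite P] (hP : InPfn 1 P) {x : P} {s : Set P}
    (hs : s.Nonempty) (h : s ⊆ minBelow P x) : s = minBelow P x :=
  Set.eq_of_subset_of_ncard_le h ((hP x).trans ((Set.ncard_pos (Set.toFinite _)).2 hs))
    (Set.toFinite _)

theorem InPfn.minBelow_eq_of_le [Finite P] (hP : InPfn 1 P) {x y : P} (h : x ≤ y) :
    minBelow P x = minBelow P y :=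
  hP.eq_minBelow (minBelow_nonempty x) (minBelow_subset_of_le h)

theorem starCondN_one_iff [Finite P] (hP : InPfn 1 P) :
    StarCondN 1 P ↔ ∀ x y w : P, w ≤ x → w ≤ y → ∃ z, IsLUB {x, y} z := by
  constructor
  · intro h x y w hx hy
    obtain ⟨z, hz, -⟩ := h x y (by
      rw [← hP.minBelow_eq_of_le hx, ← hP.minBelow_eq_of_le hy, Set.union_self]
      exact hP w)
    exact ⟨z, hz⟩
  · intro h x y hxy
    obtain ⟨m, hm⟩ := minBelow_nonempty x
    obtain ⟨n, hn⟩ := minBelow_nonempty y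
    obtain rfl : m = n :=
      (Set.ncard_le_one_iff (Set.toFinite _)).1 hxy (Or.inl hm) (Or.inr hn)
    obtain ⟨z, hz⟩ := h x y m hm.1 hn.1
    refine ⟨z, hz, ?_⟩
    rw [hP.minBelow_eq_of_le (hz.1 (by simp : x ∈ _)),
      hP.minBelow_eq_of_le (hz.1 (by simp : y ∈ _)), Set.union_self]

theorem IsPMorphism.isMin {u : P → Q} (hu : IsPMorphism u) {m : P} (hm : IsMin m) :
    IsMin (u m) :=
  (mem_minBelow_iff.1 ((hu.2 m).subset ⟨m, mem_minBelow_iff.2 ⟨le_rfl, hm⟩, rfl⟩)).2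

theorem isPMorphism_of_isMin [Finite P] [Finite Q] (hQ : InPfn 1 Q) {u : P → Q}
    (hu : Monotone u) (hmin : ∀ m, IsMin m → IsMin (u m)) : IsPMorphism u := by
  refine ⟨hu, fun x => hQ.eq_minBelow ((minBelow_nonempty x).image u) ?_⟩
  rintro _ ⟨m, hm, rfl⟩
  rw [mem_minBelow_iff] at hm ⊢
  exact ⟨hu hm.1, hmin m hm.2⟩

theorem Set.Finite.exists_isGreatest_of_directedOn {s : Set P} (hs : s.Finite)
    (hne : s.Nonempty) (hd : DirectedOn (· ≤ ·) s) : ∃ t, IsGreatest s t := by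
  obtain ⟨t, ht⟩ := hs.exists_maximal hne
  refine ⟨t, ht.1, fun y hy => ?_⟩
  obtain ⟨z, hz, htz, hyz⟩ := hd t ht.1 y hy
  exact hyz.trans (ht.2 hz htz)

theorem exists_isGLB_of_forall_exists_isLUB [Finite P]
    (h : ∀ x y : P, ∃ z, IsLUB {x, y} z) {s : Set P} (hs : (lowerBounds s).Nonempty) :
    ∃ i, IsGLB s i := by
  refine (Set.toFinite (lowerBounds s)).exists_isGreatest_of_directedOn hs ?_
  intro x hx y hy
  obtain ⟨z, hz⟩ := h x y
  refine ⟨z, fun w hw => hz.2 ?_, hz.1 (by simp), hz.1 (by simp)⟩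
  rintro v (rfl | rfl)
  exacts [hx hw, hy hw]

end Basic

/-- The disjoint union of the principal down-sets of `X`. -/
@[ext]
structure DownSum (X : Type) [PartialOrder X] where
  top : X
  val : X
  val_le : val ≤ top

namespace DownSum

variable {X : Type} [PartialOrder X]

instance : PartialOrder (DownSum X) where
  le p q := p.top = q.top ∧ p.val ≤ q.val
  le_refl _ := ⟨rfl, le_rfl⟩
  le_trans _ _ _ h h' := ⟨h.1.trans h'.1, h.2.trans h'.2⟩
  le_antisymm _ _ h h' := DownSum.ext h.1 (h.2.antisymm h'.2)

instance [Finite X] : Finite (DownSum X) :=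
  Finite.of_injective (fun p => (p.top, p.val)) fun _ _ h =>
    DownSum.ext (congrArg Prod.fst h) (congrArg Prod.snd h)

theorem isMin_iff {p : DownSum X} : IsMin p ↔ IsMin p.val :=
  ⟨fun h z hz => (h (b := ⟨p.top, z, hz.trans p.val_le⟩) ⟨rfl, hz⟩).2,
    fun h _ hq => ⟨hq.1.symm, h hq.2⟩⟩

theorem inPfn_one [Finite X] (hX : InPfn 1 X) : InPfn 1 (DownSum X) := by
  rw [inPfn_one_iff] at hX ⊢
  intro x m n hm hn hm' hn'
  exact DownSum.ext (hm.1.trans hn.1.symm)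
    (hX x.val _ _ hm.2 hn.2 (isMin_iff.1 hm') (isMin_iff.1 hn'))

theorem starCondN_one [Finite X] (hX : InPfn 1 X)
    (h : ∀ x : X, ∀ y z : {w : X // w ≤ x}, ∃ s, IsLUB {y, z} s) :
    StarCondN 1 (DownSum X) := by
  rw [starCondN_one_iff (inPfn_one hX)]
  rintro ⟨t, x, hx⟩ ⟨t', y, hy⟩ w hwx hwy
  obtain rfl : t = t' := hwx.1.symm.trans hwy.1
  obtain ⟨s, hs⟩ := h t ⟨x, hx⟩ ⟨y, hy⟩
  refine ⟨⟨t, s, s.2⟩, ?_, fun v hv => ?_⟩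
  · rintro _ (rfl | rfl)
    exacts [⟨rfl, hs.1 (Or.inl rfl)⟩, ⟨rfl, hs.1 (Or.inr rfl)⟩]
  · have h₁ := hv (Or.inl rfl)
    have h₂ := hv (Or.inr rfl)
    have ht : t = v.top := h₁.1
    have hsv : s ≤ ⟨v.val, v.val_le.trans_eq ht.symm⟩ := hs.2 (by
      rintro _ (rfl | rfl)
      exacts [h₁.2, h₂.2])
    exact ⟨ht, hsv⟩

end DownSum

/-- The lattice with atoms `left i`, `right j` and coatoms `pair i j = left i ⊔ right j`. -/
inductive Grid (T : Type) : Type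
  | bot
  | left (i : T)
  | right (j : T)
  | pair (i j : T)
  | top

namespace Grid

variable {T : Type}

/-- The order relation of `Grid T`. -/
def Rel : Grid T → Grid T → Prop
  | bot, _ => True
  | _, top => True
  | left i, left k => i = k
  | right j, right l => j = l
  | left i, pair k _ => i = k
  | right j, pair _ l => j = l
  | pair i j, pair k l => i = k ∧ j = l
  | _, _ => False

instance : PartialOrder (Grid T) where
  le := Rel
  le_refl p := by cases p <;> simp [Rel]
  le_trans p q r h h' := by cases p <;> cases q <;> cases r <;> simp_all [Rel]
  le_antisymm p q h h' := by cases p <;> cases q <;> simp_all [Rel]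

theorem le_iff_rel {p q : Grid T} : p ≤ q ↔ Rel p q := Iff.rfl

theorem bot_le (p : Grid T) : bot ≤ p := by cases p <;> simp [le_iff_rel, Rel]

theorem le_top (p : Grid T) : p ≤ top := by cases p <;> simp [le_iff_rel, Rel]

instance [Finite T] : Finite (Grid T) := by
  let f : Option (Option (T × T)) ⊕ (T ⊕ T) → Grid T := fun
    | .inl none => bot
    | .inl (some none) => top
    | .inl (some (some (i, j))) => pair i j
    | .inr (.inl i) => left i
    | .inr (.inr j) => right j
  refine Finite.of_surjective f fun p => ?_
  cases p with
  | bot => exact ⟨.inl none, rfl⟩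
  | top => exact ⟨.inl (some none), rfl⟩
  | pair i j => exact ⟨.inl (some (some (i, j))), rfl⟩
  | left i => exact ⟨.inr (.inl i), rfl⟩
  | right j => exact ⟨.inr (.inr j), rfl⟩

theorem isMin_iff {p : Grid T} : IsMin p ↔ p = bot :=
  ⟨fun h => (h.eq_of_le (bot_le p)).symm, fun h _ _ => h ▸ bot_le _⟩

theorem inPfn_one [Finite T] : InPfn 1 (Grid T) :=
  inPfn_one_iff.2 fun _ _ _ _ _ hm hn => (isMin_iff.1 hm).trans (isMin_iff.1 hn).symm

theorem exists_isLUB (p q : Grid T) : ∃ z, IsLUB {p, q} z := by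
  have key : ∀ z, p ≤ z → q ≤ z → (∀ w, p ≤ w → q ≤ w → z ≤ w) → ∃ z, IsLUB {p, q} z :=
    fun z hp hq h => ⟨z, by simp [upperBounds, hp, hq], fun w hw =>
      h w (hw (Or.inl rfl)) (hw (Or.inr rfl))⟩
  by_cases hpq : p ≤ q
  · exact key q hpq le_rfl fun w _ h => h
  by_cases hqp : q ≤ p
  · exact key p le_rfl hqp fun w h _ => h
  by_cases h : ∃ i j, p = left i ∧ q = right j ∨ p = right j ∧ q = left i
  · obtain ⟨i, j, h⟩ := h
    apply key (pair i j)
    · rcases h with ⟨rfl, rfl⟩ | ⟨rfl, rfl⟩ <;> simp [le_iff_rel, Rel]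
    · rcases h with ⟨rfl, rfl⟩ | ⟨rfl, rfl⟩ <;> simp [le_iff_rel, Rel]
    · rcases h with ⟨rfl, rfl⟩ | ⟨rfl, rfl⟩ <;> intro w <;> cases w <;>
        simp +contextual [le_iff_rel, Rel]
  · refine key top (le_top _) (le_top _) fun w => ?_
    simp only [not_exists, not_or] at h
    cases p <;> cases q <;> cases w <;> simp only [le_iff_rel, Rel] at hpq hqp h ⊢ <;> grind

theorem starCondN_one [Finite T] : StarCondN 1 (Grid T) :=
  (starCondN_one_iff inPfn_one).2 fun p q _ _ _ => exists_isLUB p q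

open Classical in
/-- The map from `Grid T` taking the diagonal coatoms to `c` and the others to `d`. -/
noncomputable def diagMap {X : Type} (m a b c d x : X) : Grid T → X
  | bot => m
  | left _ => a
  | right _ => b
  | pair i j => if i = j then c else d
  | top => x

theorem isPMorphism_diagMap {X : Type} [PartialOrder X] [Finite X] [Finite T]
    (hX : InPfn 1 X) {m a b c d x : X} (hm : IsMin m) (hma : m ≤ a) (hmb : m ≤ b)
    (hac : a ≤ c) (hbc : b ≤ c) (had : a ≤ d) (hbd : b ≤ d) (hcx : c ≤ x) (hdx : d ≤ x) :
    IsPMorphism (diagMap m a b c d x : Grid T → X) := by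
  refine isPMorphism_of_isMin hX ?_ fun p hp => by rwa [isMin_iff.1 hp]
  have hmc := hma.trans hac
  have hmd := hma.trans had
  have hax := hac.trans hcx
  have hbx := hbc.trans hcx
  have hmx := hma.trans hax
  rintro p q h
  rw [le_iff_rel] at h
  cases p <;> cases q <;> simp only [Rel] at h <;> simp only [diagMap] <;> grind

end Grid

namespace UnifierN

variable {X : Type} [PartialOrder X] [Finite X]

/-- The disjoint union of two `1`-unifiers. -/
def coprod (v w : UnifierN 1 X) (hX : InPfn 1 X) : UnifierN 1 X :=
  have hP : InPfn 1 (v.Y ⊕ w.Y) := by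
    rw [inPfn_one_iff]
    have hv := inPfn_one_iff.1 v.mem
    have hw := inPfn_one_iff.1 w.mem
    rintro (x | x) (m | m) (n | n) hm hn hm' hn' <;>
      simp_all [Sum.isMin_inl_iff, Sum.isMin_inr_iff]
    · exact hv x m n hm hn hm' hn'
    · exact hw x m n hm hn hm' hn'
  { Y := v.Y ⊕ w.Y
    ne := v.ne.map Sum.inl
    mem := hP
    star := by
      have hv := (starCondN_one_iff v.mem).1 v.star
      have hw := (starCondN_one_iff w.mem).1 w.star
      rw [starCondN_one_iff hP]
      rintro (x | x) (y | y) (r | r) hx hy <;> simp at hx hy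
      · obtain ⟨z, hz⟩ := hv x y r hx hy
        refine ⟨Sum.inl z, ?_⟩
        simp_all [IsLUB, IsLeast, upperBounds, lowerBounds]
      · obtain ⟨z, hz⟩ := hw x y r hx hy
        refine ⟨Sum.inr z, ?_⟩
        simp_all [IsLUB, IsLeast, upperBounds, lowerBounds]
    u := Sum.elim v.u w.u
    hu := by
      refine isPMorphism_of_isMin hX ?_ ?_
      · rintro (x | x) (y | y) h <;> simp at h
        exacts [v.hu.1 h, w.hu.1 h]
      · rintro (m | m) hm
        exacts [v.hu.isMin (Sum.isMin_inl_iff.1 hm), w.hu.isMin (Sum.isMin_inr_iff.1 hm)] }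

theorem le_coprod_left (v w : UnifierN 1 X) (hX : InPfn 1 X) :
    UnifierNLE v (v.coprod w hX) :=
  ⟨Sum.inl, isPMorphism_of_isMin (v.coprod w hX).mem (fun _ _ h => Sum.inl_le_inl_iff.2 h)
    fun _ hm => Sum.isMin_inl_iff.2 hm, rfl⟩

theorem le_coprod_right (v w : UnifierN 1 X) (hX : InPfn 1 X) :
    UnifierNLE w (v.coprod w hX) :=
  ⟨Sum.inr, isPMorphism_of_isMin (v.coprod w hX).mem (fun _ _ h => Sum.inr_le_inr_iff.2 h)
    fun _ hm => Sum.isMin_inr_iff.2 hm, rfl⟩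

theorem le_trans {v w z : UnifierN 1 X} (h : UnifierNLE v w) (h' : UnifierNLE w z) :
    UnifierNLE v z := by
  obtain ⟨f, hf, hfu⟩ := h
  obtain ⟨g, hg, hgu⟩ := h'
  refine ⟨g ∘ f, isPMorphism_of_isMin z.mem (hg.1.comp hf.1)
    fun m hm => hg.isMin (hf.isMin hm), ?_⟩
  exact (congrArg (· ∘ f) hgu).trans hfu

/-- Members of a minimal complete set of `1`-unifiers are greatest. -/
theorem le_of_mem_isMinimalCompleteSet (hX : InPfn 1 X) {M : Set (UnifierN 1 X)}
    (hM : IsMinimalCompleteSet UnifierNLE M) {v : UnifierN 1 X} (hv : v ∈ M)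
    (w : UnifierN 1 X) : UnifierNLE w v := by
  obtain ⟨z, hz, hle⟩ := hM.1 (v.coprod w hX)
  obtain rfl := hM.2 v hv z hz (le_trans (le_coprod_left v w hX) hle)
  exact le_trans (le_coprod_right v w hX) hle

/-- The `1`-unifier given by all principal down-sets, when they are lattices. -/
def downSum [Nonempty X] (hX : InPfn 1 X)
    (h : ∀ x : X, ∀ y z : {w : X // w ≤ x}, ∃ s, IsLUB {y, z} s) : UnifierN 1 X where
  Y := DownSum X
  ne := ‹Nonempty X›.map fun x => ⟨x, x, le_rfl⟩
  mem := DownSum.inPfn_one hX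
  star := DownSum.starCondN_one hX h
  u := DownSum.val
  hu := isPMorphism_of_isMin hX (fun _ _ h => h.2) fun _ hm => DownSum.isMin_iff.1 hm

theorem le_downSum [Nonempty X] (hX : InPfn 1 X)
    (h : ∀ x : X, ∀ y z : {w : X // w ≤ x}, ∃ s, IsLUB {y, z} s) (v : UnifierN 1 X) :
    UnifierNLE v (downSum hX h) := by
  have key : ∀ y : v.Y, ∃ t, IsGreatest {w | minBelow v.Y w = minBelow v.Y y} t := by
    intro y
    refine (Set.toFinite _).exists_isGreatest_of_directedOn ⟨y, rfl⟩ ?_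
    intro a ha b hb
    simp only [Set.mem_ofPred_eq] at ha hb
    obtain ⟨z, hz, hz'⟩ := v.star a b (by rw [ha, hb, Set.union_self]; exact v.mem y)
    exact ⟨z, by simp [hz', ha, hb], hz.1 (by simp), hz.1 (by simp)⟩
  choose t ht using key
  refine ⟨fun y => ⟨v.u (t y), v.u y, v.hu.1 ((ht y).2 rfl)⟩,
    isPMorphism_of_isMin (downSum hX h).mem ?_ ?_, rfl⟩
  · intro y y' hy
    refine ⟨congrArg v.u ((ht y).unique ?_), v.hu.1 hy⟩
    rw [v.mem.minBelow_eq_of_le hy]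
    exact ht y'
  · exact fun m hm => DownSum.isMin_iff.2 (v.hu.isMin hm)

/-- The `1`-unifier `Grid.diagMap`. -/
noncomputable def diag (T : Type) [Finite T] (hX : InPfn 1 X) {m a b c d x : X}
    (hm : IsMin m) (hma : m ≤ a) (hmb : m ≤ b) (hac : a ≤ c) (hbc : b ≤ c) (had : a ≤ d)
    (hbd : b ≤ d) (hcx : c ≤ x) (hdx : d ≤ x) : UnifierN 1 X where
  Y := Grid T
  ne := ⟨Grid.bot⟩
  mem := Grid.inPfn_one
  star := Grid.starCondN_one
  u := Grid.diagMap m a b c d x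
  hu := Grid.isPMorphism_diagMap hX hm hma hmb hac hbc had hbd hcx hdx

theorem injective_left_of_diagMap_factors (v : UnifierN 1 X) {T : Type} {m a b c d x : X}
    (hc : ∀ e, a ≤ e → b ≤ e → e ≤ c → c ≤ e) (hcd : ¬ c ≤ d) {ψ : Grid T → v.Y}
    (hψ : Monotone ψ) (h : v.u ∘ ψ = Grid.diagMap m a b c d x) :
    Function.Injective fun i => ψ (Grid.left i) := by
  intro i j hij
  by_contra hne
  simp only at hij
  have hu : ∀ p, v.u (ψ p) = Grid.diagMap m a b c d x p := fun p => congrFun h p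
  obtain ⟨z, hz⟩ := (starCondN_one_iff v.mem).1 v.star (ψ (.left i)) (ψ (.right i)) (ψ .bot)
    (hψ (Grid.bot_le _)) (hψ (Grid.bot_le _))
  have hzc : z ≤ ψ (.pair i i) := hz.2 (by
    rintro _ (rfl | rfl) <;> exact hψ (by simp [Grid.le_iff_rel, Grid.Rel]))
  have hzd : z ≤ ψ (.pair j i) := hz.2 (by
    rintro _ (rfl | rfl)
    · rw [hij]; exact hψ (by simp [Grid.le_iff_rel, Grid.Rel])
    · exact hψ (by simp [Grid.le_iff_rel, Grid.Rel]))
  have haz := v.hu.1 (hz.1 (Or.inl rfl))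
  have hbz := v.hu.1 (hz.1 (Or.inr rfl))
  have hzuc := v.hu.1 hzc
  have hzud := v.hu.1 hzd
  rw [hu] at haz hbz hzuc hzud
  simp only [Grid.diagMap, if_true, if_neg (Ne.symm hne)] at haz hbz hzuc hzud
  exact hcd ((hc _ haz hbz hzuc).trans hzud)

/-- If some `1`-unifier is greatest, then principal down-sets have binary joins. -/
theorem exists_isLUB_of_isGreatest (hX : InPfn 1 X) {v : UnifierN 1 X}
    (hv : ∀ w, UnifierNLE w v) (x : X) (y z : {w : X // w ≤ x}) : ∃ s, IsLUB {y, z} s := by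
  by_contra! hno
  obtain ⟨c, hc⟩ := (Set.toFinite (upperBounds {y, z})).exists_minimal
    ⟨⟨x, le_rfl⟩, fun w _ => w.2⟩
  obtain ⟨d, hd, hcd⟩ : ∃ d ∈ upperBounds {y, z}, ¬ c ≤ d := by
    by_contra! hcon
    exact hno c ⟨hc.1, hcon⟩
  obtain ⟨m, hmy, hm⟩ := exists_isMin_le (y : X)
  obtain ⟨n, hnz, hn⟩ := exists_isMin_le (z : X)
  obtain rfl : m = n :=
    inPfn_one_iff.1 hX x m n (hmy.trans y.2) (hnz.trans z.2) hm hn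
  obtain ⟨ψ, hψ, hcomp⟩ := hv (diag (Set v.Y) hX hm hmy hnz (hc.1 (Or.inl rfl))
    (hc.1 (Or.inr rfl)) (hd (Or.inl rfl)) (hd (Or.inr rfl)) c.2 d.2)
  refine Function.cantor_injective _
    (v.injective_left_of_diagMap_factors ?_ hcd hψ.1 hcomp)
  intro e hye hze hec
  refine hc.2 (y := ⟨e, hec.trans c.2⟩) ?_ hec
  rintro _ (rfl | rfl)
  exacts [hye, hze]

end UnifierN

/-- Classification in `P^f_1`: a nonempty finite poset in `P^f_1` has type 1 if every
principal down-set is a lattice, and type 0 otherwise. -/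
theorem pfOne_classification (X : Type) [PartialOrder X] [Finite X] [Nonempty X]
    (hX : InPfn 1 X) :
    ((∀ x : X, ∀ y z : {w : X // w ≤ x},
        (∃ s, IsLUB {y, z} s) ∧ (∃ i, IsGLB {y, z} i)) →
      ∃ M : Set (UnifierN 1 X), IsMinimalCompleteSet UnifierNLE M ∧ M.ncard = 1) ∧
    ((¬ ∀ x : X, ∀ y z : {w : X // w ≤ x},
        (∃ s, IsLUB {y, z} s) ∧ (∃ i, IsGLB {y, z} i)) →
      ¬ ∃ M : Set (UnifierN 1 X), IsMinimalCompleteSet UnifierNLE M) := by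
  refine ⟨fun h => ?_, fun h => ?_⟩
  · have h' : ∀ x : X, ∀ y z : {w : X // w ≤ x}, ∃ s, IsLUB {y, z} s :=
      fun x y z => (h x y z).1
    refine ⟨{UnifierN.downSum hX h'}, ⟨fun v => ⟨_, rfl, UnifierN.le_downSum hX h' v⟩, ?_⟩,
      Set.ncard_singleton _⟩
    rintro _ rfl _ rfl _
    rfl
  · rintro ⟨M, hM⟩
    apply h
    obtain ⟨m, -, hm⟩ := exists_isMin_le (Classical.arbitrary X)
    obtain ⟨v, hv, -⟩ := hM.1 (UnifierN.diag Unit hX hm le_rfl le_rfl le_rfl le_rfl le_rfl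
      le_rfl le_rfl le_rfl)
    have hlub := UnifierN.exists_isLUB_of_isGreatest hX
      (UnifierN.le_of_mem_isMinimalCompleteSet hX hM hv)
    refine fun x y z => ⟨hlub x y z, exists_isGLB_of_forall_exists_isLUB (hlub x) ?_⟩
    obtain ⟨m, hmy, hm⟩ := exists_isMin_le (y : X)
    obtain ⟨n, hnz, hn⟩ := exists_isMin_le (z : X)
    obtain rfl : m = n :=
      inPfn_one_iff.1 hX x m n (hmy.trans y.2) (hnz.trans z.2) hm hn
    refine ⟨⟨m, hmy.trans y.2⟩, ?_⟩
    rintro _ (rfl | rfl)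
    exacts [hmy, hnz]
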